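/- Let $V=S^1\times D^2_\delta$ be the solid torus with coordinate $\theta\in\mathbb{R}/2\pi\mathbb{Z}$ and polar coordinates $(r,\phi)$ on the disk of radius $\delta$. Let $\alpha=h\cdot(d\theta+r^2d\phi)$ be a positive contact form on $V$ ($h$ smooth and positive). Let $n\in\mathbb{N}$, let $\Theta:S^1\to S^1$ be an orientation-preserving diffeomorphism (viewed as a function of $\theta$ only) with $d\Theta\wedge d\alpha>0$ on $V$, and let $f:V\to\mathbb{R}$ be a smooth function vanishing on the core circle $\{r=0\}$ such that the map $\pi:=n\Theta+f:V\to S^1$ satisfies $d\pi\wedge d\alpha>0$ on $V$. Then there exists $\varepsilon_0>0$ such that for every smooth nondecreasing function $\rho:[0,\delta]\to[0,1]$ which vanishes near $0$, is constant equal to $1$ near $\delta$, and satisfies $r\rho'(r)\le\varepsilon_0$ for all $r$, the map $\pi_1:=n\Theta+\rho(r)f:V\to S^1$ satisfies $d\pi_1\wedge d\alpha>0$ on $V$ (in particular $\pi_1$ is a submersion). -/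

import Mathlib

open Set Real

/-- A point of the solid torus `S¹ × D²`, in coordinates `(θ, x, y)`: the first
coordinate is the angle along `S¹` (functions on the solid torus are required to be
periodic in it), and `(x,y)` are Cartesian coordinates on the disk, with associated
polar coordinates `(r,φ)`. -/
abbrev Pt : Type := ℝ × ℝ × ℝ

/-- Partial derivative in the angular (first) coordinate. -/
noncomputable def pdA (f : Pt → ℝ) (q : Pt) : ℝ := fderiv ℝ f q (1, 0, 0)
/-- Partial derivative in `x`. -/
noncomputable def pdX (f : Pt → ℝ) (q : Pt) : ℝ := fderiv ℝ f q (0, 1, 0)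
/-- Partial derivative in `y`. -/
noncomputable def pdY (f : Pt → ℝ) (q : Pt) : ℝ := fderiv ℝ f q (0, 0, 1)

/-- The coefficient, with respect to the orientation form `dθ∧dx∧dy`, of the 3-form
`c ∧ db`, where the 1-forms `c` and `b` are described by their coefficient functions
with respect to `(dθ, dx, dy)`. -/
noncomputable def wedgeD (c b : Pt → Pt) (q : Pt) : ℝ :=
  (c q).1 * (pdX (fun p => (b p).2.2) q - pdY (fun p => (b p).2.1) q)
  - (c q).2.1 * (pdA (fun p => (b p).2.2) q - pdY (fun p => (b p).1) q)
  + (c q).2.2 * (pdA (fun p => (b p).2.1) q - pdX (fun p => (b p).1) q)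

/-- The differential of a function, as a 1-form (coefficients w.r.t. `(dθ,dx,dy)`). -/
noncomputable def gradOf (f : Pt → ℝ) (q : Pt) : Pt := (pdA f q, pdX f q, pdY f q)

/-- The radial coordinate on the disk factor. -/
noncomputable def rad (q : Pt) : ℝ := Real.sqrt (q.2.1 ^ 2 + q.2.2 ^ 2)

/-- The solid torus of disk-radius `δ` (the angular coordinate ranges over all of `ℝ`;
periodicity is imposed on the functions involved). -/
def Vset (δ : ℝ) : Set Pt := {q | q.2.1 ^ 2 + q.2.2 ^ 2 ≤ δ ^ 2}

/-- Periodicity in the angular coordinate, for functions. -/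
def IsPeriodic (P : ℝ) (f : Pt → ℝ) : Prop := ∀ q : Pt, f (q.1 + P, q.2) = f q

/-- Periodicity in the angular coordinate, for (coefficient functions of) 1-forms. -/
def IsPeriodicForm (P : ℝ) (α : Pt → Pt) : Prop := ∀ q : Pt, α (q.1 + P, q.2) = α q

/-- The standard contact form `α_st = dθ + r²dφ = dθ + x dy - y dx` on the solid
torus, given by its coefficients `(1, -y, x)` w.r.t. `(dθ, dx, dy)`. -/
def alphaSt : Pt → Pt := fun q => (1, -q.2.2, q.2.1)



lemma wedge_formula (h : Pt → ℝ) (q : Pt) (hd : DifferentiableAt ℝ h q) (c : Pt → Pt) :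
    wedgeD c (fun x => h x • alphaSt x) q =
      (c q).1 * (2 * h q + q.2.1 * pdX h q + q.2.2 * pdY h q)
      + (c q).2.1 * (pdY h q - q.2.1 * pdA h q)
      + (c q).2.2 * (- q.2.2 * pdA h q - pdX h q) := by
  have hx : HasFDerivAt (fun p : Pt => p.2.1)
      ((ContinuousLinearMap.fst ℝ ℝ ℝ).comp (ContinuousLinearMap.snd ℝ ℝ (ℝ × ℝ))) q :=
    ((ContinuousLinearMap.fst ℝ ℝ ℝ).comp (ContinuousLinearMap.snd ℝ ℝ (ℝ × ℝ))).hasFDerivAt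
  have hy : HasFDerivAt (fun p : Pt => p.2.2)
      ((ContinuousLinearMap.snd ℝ ℝ ℝ).comp (ContinuousLinearMap.snd ℝ ℝ (ℝ × ℝ))) q :=
    ((ContinuousLinearMap.snd ℝ ℝ ℝ).comp (ContinuousLinearMap.snd ℝ ℝ (ℝ × ℝ))).hasFDerivAt
  have e1 := (hd.hasFDerivAt.mul hx).fderiv
  have e2 := (hd.hasFDerivAt.mul hy.neg).fderiv
  have f1 : (fun p : Pt => (h p • alphaSt p).2.2) = h * (fun p : Pt => p.2.1) := by
    funext p; simp [alphaSt]
  have f2 : (fun p : Pt => (h p • alphaSt p).2.1) = h * (-fun p : Pt => p.2.2) := by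
    funext p; simp [alphaSt]
  have f3 : (fun p : Pt => (h p • alphaSt p).1) = h := by
    funext p; simp [alphaSt]
  unfold wedgeD
  rw [f1, f2, f3]
  unfold pdA pdX pdY
  rw [e1, e2]
  simp
  ring

lemma rad_hasFDerivAt (q : Pt) (hq : 0 < rad q) :
    ∃ L : Pt →L[ℝ] ℝ, HasFDerivAt rad L q ∧
      ∀ v : Pt, L v = (q.2.1 * v.2.1 + q.2.2 * v.2.2) / rad q := by
  have hx : HasFDerivAt (fun p : Pt => p.2.1)
      ((ContinuousLinearMap.fst ℝ ℝ ℝ).comp (ContinuousLinearMap.snd ℝ ℝ (ℝ × ℝ))) q :=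
    ((ContinuousLinearMap.fst ℝ ℝ ℝ).comp (ContinuousLinearMap.snd ℝ ℝ (ℝ × ℝ))).hasFDerivAt
  have hy : HasFDerivAt (fun p : Pt => p.2.2)
      ((ContinuousLinearMap.snd ℝ ℝ ℝ).comp (ContinuousLinearMap.snd ℝ ℝ (ℝ × ℝ))) q :=
    ((ContinuousLinearMap.snd ℝ ℝ ℝ).comp (ContinuousLinearMap.snd ℝ ℝ (ℝ × ℝ))).hasFDerivAt
  have hne : q.2.1 ^ 2 + q.2.2 ^ 2 ≠ 0 := by
    intro h0; simp [rad, h0] at hq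
  refine ⟨_, ((hx.pow 2).add (hy.pow 2)).sqrt hne, ?_⟩
  intro v
  have : √(q.2.1 ^ 2 + q.2.2 ^ 2) ≠ 0 := hq.ne'
  simp [rad]
  field_simp

lemma grad_formula (n : ℕ) (T : ℝ → ℝ) (q : Pt) (hT : DifferentiableAt ℝ T q.1)
    (g : Pt → ℝ) (hg : DifferentiableAt ℝ g q) :
    gradOf (fun x => n * T x.1 + g x) q
      = (n * deriv T q.1 + pdA g q, pdX g q, pdY g q) := by
  have h1 : HasFDerivAt (fun p : Pt => p.1) (ContinuousLinearMap.fst ℝ ℝ (ℝ × ℝ)) q :=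
    (ContinuousLinearMap.fst ℝ ℝ (ℝ × ℝ)).hasFDerivAt
  have h2 := (hT.hasDerivAt.comp_hasFDerivAt q h1).const_mul (n : ℝ)
  have h3 := (h2.add hg.hasFDerivAt).fderiv
  have h4 : (fun x : Pt => n * T x.1 + g x)
    = (fun p : Pt => (n : ℝ) * (T ∘ fun p : Pt => p.1) p) + g := rfl
  unfold gradOf pdA pdX pdY
  rw [h4, h3]
  simp

lemma cut_formula (ρ : ℝ → ℝ) (f : Pt → ℝ) (q : Pt) (hq : 0 < rad q)
    (hρ : DifferentiableAt ℝ ρ (rad q)) (hf : DifferentiableAt ℝ f q) :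
    DifferentiableAt ℝ (fun x => ρ (rad x) * f x) q ∧
    pdA (fun x => ρ (rad x) * f x) q = ρ (rad q) * pdA f q ∧
    pdX (fun x => ρ (rad x) * f x) q
      = ρ (rad q) * pdX f q + f q * deriv ρ (rad q) * (q.2.1 / rad q) ∧
    pdY (fun x => ρ (rad x) * f x) q
      = ρ (rad q) * pdY f q + f q * deriv ρ (rad q) * (q.2.2 / rad q) := by
  obtain ⟨L, hL, hLv⟩ := rad_hasFDerivAt q hq
  have h1 := (hρ.hasDerivAt.comp_hasFDerivAt q hL).mul hf.hasFDerivAt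
  have h2 : (fun x => ρ (rad x) * f x) = (ρ ∘ rad) * f := rfl
  rw [h2]
  refine ⟨h1.differentiableAt, ?_, ?_, ?_⟩
  all_goals
    simp only [pdA, pdX, pdY]
    rw [h1.fderiv]
    simp [hLv]
    try ring

lemma exists_rep (θ : ℝ) : ∃ k : ℤ, θ - k * (2 * π) ∈ Icc (0:ℝ) (2 * π) := by
  obtain ⟨k, hk, -⟩ := existsUnique_sub_zsmul_mem_Ico (a := 2 * π) Real.two_pi_pos θ 0
  refine ⟨k, ?_⟩
  simp only [zsmul_eq_mul, zero_add] at hk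
  exact ⟨hk.1, hk.2.le⟩

lemma per_int (F : Pt → ℝ) (hF : IsPeriodic (2 * π) F) (q : Pt) (k : ℤ) :
    F (q.1 - k * (2 * π), q.2) = F q := by
  have : Function.Periodic (fun t => F (t, q.2)) (2 * π) := fun t => hF (t, q.2)
  exact this.sub_int_mul_eq k

lemma compactK (δ : ℝ) (hδ : 0 < δ) :
    IsCompact ((Icc (0:ℝ) (2 * π) ×ˢ (Icc (-δ) δ ×ˢ Icc (-δ) δ)) ∩ Vset δ) := by
  apply IsCompact.inter_right
  · exact isCompact_Icc.prod (isCompact_Icc.prod isCompact_Icc)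
  · apply isClosed_le <;> fun_prop

lemma mem_K (δ : ℝ) (hδ : 0 < δ) (q : Pt) (hq : q ∈ Vset δ) :
    ∃ k : ℤ, (q.1 - k * (2 * π), q.2) ∈
      ((Icc (0:ℝ) (2 * π) ×ˢ (Icc (-δ) δ ×ˢ Icc (-δ) δ)) ∩ Vset δ) := by
  obtain ⟨k, hk⟩ := exists_rep q.1
  have hq' : q.2.1 ^ 2 + q.2.2 ^ 2 ≤ δ ^ 2 := hq
  refine ⟨k, ⟨hk, ?_, ?_⟩, hq⟩
  · exact abs_le.1 (abs_le_of_sq_le_sq (by nlinarith [sq_nonneg q.2.2]) hδ.le)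
  · exact abs_le.1 (abs_le_of_sq_le_sq (by nlinarith [sq_nonneg q.2.1]) hδ.le)

lemma lower_bd (δ : ℝ) (hδ : 0 < δ) (F : Pt → ℝ) (hc : Continuous F)
    (hp : IsPeriodic (2 * π) F) (hpos : ∀ q ∈ Vset δ, 0 < F q) :
    ∃ m > 0, ∀ q ∈ Vset δ, m ≤ F q := by
  have h0 : (0 : Pt) ∈ Vset δ := by simp [Vset]; positivity
  obtain ⟨k, hk⟩ := mem_K δ hδ 0 h0
  obtain ⟨p, hpK, hmin⟩ := (compactK δ hδ).exists_isMinOn ⟨_, hk⟩ hc.continuousOn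
  refine ⟨F p, hpos p hpK.2, fun q hq => ?_⟩
  obtain ⟨j, hj⟩ := mem_K δ hδ q hq
  rw [← per_int F hp q j]
  exact hmin hj

lemma upper_bd (δ : ℝ) (hδ : 0 < δ) (F : Pt → ℝ) (hc : Continuous F)
    (hp : IsPeriodic (2 * π) F) :
    ∃ M > 0, ∀ q ∈ Vset δ, F q ≤ M := by
  obtain ⟨m, hm, hb⟩ := lower_bd δ hδ (fun q => Real.exp (- F q)) (by fun_prop)
    (fun q => by simp only [hp q]) (fun q _ => Real.exp_pos _)
  refine ⟨|-Real.log m| + 1, by positivity, fun q hq => ?_⟩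
  have := (Real.le_log_iff_exp_le (x := Real.log m) (Real.exp_pos (- F q))).2
    (by rw [Real.exp_log hm]; exact hb q hq)
  rw [Real.log_exp] at this
  linarith [le_abs_self (-Real.log m)]

lemma fderiv_per (F : Pt → ℝ) (hp : IsPeriodic (2 * π) F) (q : Pt) :
    fderiv ℝ F (q.1 + 2 * π, q.2) = fderiv ℝ F q := by
  have e : (fun x : Pt => F (x + ((2 * π, 0, 0) : Pt))) = F := by
    funext x
    rw [← hp x]
    congr 1
    ext <;> simp
  have := fderiv_comp_add_right (𝕜 := ℝ) (f := F) (x := q) ((2 * π, 0, 0) : Pt)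
  rw [e] at this
  rw [this]
  congr 1
  ext <;> simp

lemma fderiv_bd (δ : ℝ) (hδ : 0 < δ) (F : Pt → ℝ) (hs : ContDiff ℝ (⊤ : ℕ∞) F)
    (hp : IsPeriodic (2 * π) F) : ∃ M > 0, ∀ q ∈ Vset δ, ‖fderiv ℝ F q‖ ≤ M :=
  upper_bd δ hδ (fun q => ‖fderiv ℝ F q‖) (hs.continuous_fderiv (by simp)).norm
    (fun q => by simp only [fderiv_per F hp q])

lemma convexV (δ : ℝ) (hδ : 0 < δ) : Convex ℝ (Vset δ) := by
  intro p hp q hq a b ha hb hab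
  simp only [Vset, mem_setOf_eq, Prod.snd_add, Prod.smul_snd, Prod.fst_add, Prod.smul_fst,
    smul_eq_mul] at *
  have : b = 1 - a := by linarith
  subst this
  nlinarith [mul_nonneg (mul_nonneg ha hb) (sq_nonneg (p.2.1 - q.2.1)),
    mul_nonneg (mul_nonneg ha hb) (sq_nonneg (p.2.2 - q.2.2)),
    mul_le_mul_of_nonneg_left hp ha, mul_le_mul_of_nonneg_left hq hb]

lemma abs_x_le (q : Pt) : |q.2.1| ≤ rad q := by
  apply Real.abs_le_sqrt; nlinarith [sq_nonneg q.2.2]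

lemma abs_y_le (q : Pt) : |q.2.2| ≤ rad q := by
  apply Real.abs_le_sqrt; nlinarith [sq_nonneg q.2.1]

lemma rad_le (δ : ℝ) (hδ : 0 < δ) (q : Pt) (hq : q ∈ Vset δ) : rad q ≤ δ :=
  Real.sqrt_le_iff.2 ⟨hδ.le, hq⟩

lemma f_bd (δ : ℝ) (hδ : 0 < δ) (f : Pt → ℝ) (hs : ContDiff ℝ (⊤ : ℕ∞) f)
    (hcore : ∀ θ : ℝ, f (θ, 0, 0) = 0) (M : ℝ) (hM : 0 < M)
    (hb : ∀ q ∈ Vset δ, ‖fderiv ℝ f q‖ ≤ M) (q : Pt) (hq : q ∈ Vset δ) :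
    |f q| ≤ M * rad q := by
  have h0 : ((q.1, 0, 0) : Pt) ∈ Vset δ := by simp [Vset]; positivity
  have := (convexV δ hδ).norm_image_sub_le_of_norm_fderiv_le
    (fun x _ => (hs.differentiable (by simp)) x) hb h0 hq
  rw [hcore, sub_zero, Real.norm_eq_abs] at this
  refine this.trans (mul_le_mul_of_nonneg_left ?_ hM.le)
  rw [Prod.norm_def, Prod.norm_def]
  simp [abs_x_le, abs_y_le, rad]
  exact ⟨abs_x_le q, abs_y_le q⟩

lemma pd_bd (F : Pt → ℝ) (q : Pt) (M : ℝ) (hb : ‖fderiv ℝ F q‖ ≤ M) :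
    |pdA F q| ≤ M ∧ |pdX F q| ≤ M ∧ |pdY F q| ≤ M := by
  refine ⟨?_, ?_, ?_⟩
  · have := (fderiv ℝ F q).le_opNorm (1, 0, 0)
    simp [Prod.norm_def] at this
    exact this.trans hb
  · have := (fderiv ℝ F q).le_opNorm (0, 1, 0)
    simp [Prod.norm_def] at this
    exact this.trans hb
  · have := (fderiv ℝ F q).le_opNorm (0, 0, 1)
    simp [Prod.norm_def] at this
    exact this.trans hb

lemma pd_cont (F : Pt → ℝ) (hs : ContDiff ℝ (⊤ : ℕ∞) F) :
    Continuous (pdA F) ∧ Continuous (pdX F) ∧ Continuous (pdY F) := by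
  have := hs.continuous_fderiv (by simp)
  exact ⟨this.clm_apply continuous_const, this.clm_apply continuous_const,
    this.clm_apply continuous_const⟩

lemma pd_per (F : Pt → ℝ) (hp : IsPeriodic (2 * π) F) :
    IsPeriodic (2 * π) (pdA F) ∧ IsPeriodic (2 * π) (pdX F) ∧ IsPeriodic (2 * π) (pdY F) := by
  refine ⟨fun q => ?_, fun q => ?_, fun q => ?_⟩ <;> simp only [pdA, pdX, pdY, fderiv_per F hp q]

lemma rho_deriv_nonneg (δ : ℝ) (hδ : 0 < δ) (ρ : ℝ → ℝ) (hs : ContDiff ℝ (⊤ : ℕ∞) ρ)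
    (hm : MonotoneOn ρ (Icc 0 δ)) (r : ℝ) (hr : r ∈ Icc 0 δ) : 0 ≤ deriv ρ r := by
  rw [← ((hs.differentiable (by simp)) r).derivWithin (uniqueDiffOn_Icc hδ r hr)]
  exact hm.derivWithin_nonneg

/-- **Cutting off the fibration towards the core (Step 2 of the standardization).**
On `V = S¹ × D²_δ` (angle `θ` of period `2π`), let `α = h·(dθ + r²dφ)` be a
positive contact form (`h > 0`). Let `n ∈ ℕ`, let `Θ` be an orientation-preserving
diffeomorphism of `S¹` (a function of `θ` only, encoded by a lift `T : ℝ → ℝ` with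
`T(θ+2π) = T(θ)+2π` and `T' > 0`) with `dΘ∧dα > 0` on `V`, and let `f` be a smooth
function vanishing on the core circle such that `π := nΘ + f` satisfies
`dπ∧dα > 0` on `V`. Then there exists `ε₀ > 0` such that for every smooth
nondecreasing `ρ : [0,δ] → [0,1]` vanishing near `0`, constant `1` near `δ`, with
`r ρ'(r) ≤ ε₀`, the map `π₁ := nΘ + ρ(r)f` satisfies `dπ₁∧dα > 0` on `V`
(in particular `π₁` is a submersion). -/
theorem stmt_4 (δ : ℝ) (hδ : 0 < δ)
    (h : Pt → ℝ) (hhsm : ContDiff ℝ (⊤ : ℕ∞) h) (hhper : IsPeriodic (2 * π) h)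
    (hhpos : ∀ q ∈ Vset δ, 0 < h q)
    (hcontact : ∀ q ∈ Vset δ,
      0 < wedgeD (fun x => h x • alphaSt x) (fun x => h x • alphaSt x) q)
    (n : ℕ) (hn : 0 < n)
    (T : ℝ → ℝ) (hTsm : ContDiff ℝ (⊤ : ℕ∞) T)
    (hTequiv : ∀ θ : ℝ, T (θ + 2 * π) = T θ + 2 * π)
    (hT' : ∀ θ : ℝ, 0 < deriv T θ)
    (hTwedge : ∀ q ∈ Vset δ,
      0 < wedgeD (fun x => (deriv T x.1, 0, 0)) (fun x => h x • alphaSt x) q)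
    (f : Pt → ℝ) (hfsm : ContDiff ℝ (⊤ : ℕ∞) f) (hfper : IsPeriodic (2 * π) f)
    (hfcore : ∀ θ : ℝ, f (θ, 0, 0) = 0)
    (hπ : ∀ q ∈ Vset δ,
      0 < wedgeD (gradOf (fun x => n * T x.1 + f x)) (fun x => h x • alphaSt x) q) :
    ∃ ε₀ > 0, ∀ ρ : ℝ → ℝ, ContDiff ℝ (⊤ : ℕ∞) ρ →
      MonotoneOn ρ (Icc 0 δ) →
      (∀ r ∈ Icc (0:ℝ) δ, ρ r ∈ Icc (0:ℝ) 1) →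
      (∃ a > 0, ∀ r ∈ Icc (0:ℝ) δ, r ≤ a → ρ r = 0) →
      (∃ b ∈ Ioo 0 δ, ∀ r ∈ Icc (0:ℝ) δ, b ≤ r → ρ r = 1) →
      (∀ r ∈ Icc (0:ℝ) δ, r * deriv ρ r ≤ ε₀) →
      ∀ q ∈ Vset δ,
        0 < wedgeD (gradOf (fun x => n * T x.1 + ρ (rad x) * f x))
              (fun x => h x • alphaSt x) q ∧
        gradOf (fun x => n * T x.1 + ρ (rad x) * f x) q ≠ 0 := by
  have hhd : Differentiable ℝ h := hhsm.differentiable (by simp)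
  have hfd : Differentiable ℝ f := hfsm.differentiable (by simp)
  have hTd : Differentiable ℝ T := hTsm.differentiable (by simp)
  have hTc : Continuous (deriv T) := hTsm.continuous_deriv (by simp)
  have hTp : ∀ θ, deriv T (θ + 2 * π) = deriv T θ := by
    intro θ
    rw [← deriv_comp_add_const]
    simp only [hTequiv]
    simp
  obtain ⟨hAc, hXc, hYc⟩ := pd_cont h hhsm
  obtain ⟨fAc, fXc, fYc⟩ := pd_cont f hfsm
  obtain ⟨hAp, hXp, hYp⟩ := pd_per h hhper
  obtain ⟨fAp, fXp, fYp⟩ := pd_per f hfper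
  have hhc := hhsm.continuous
  obtain ⟨m₁, hm₁, hA⟩ := lower_bd δ hδ
    (fun q => deriv T q.1 * (2 * h q + q.2.1 * pdX h q + q.2.2 * pdY h q))
    (by fun_prop)
    (fun q => by
      simp only [hTp, hhper q, hXp q, hYp q])
    (fun q hq => by
      have := hTwedge q hq
      rw [wedge_formula h q (hhd q)] at this
      simpa using this)
  obtain ⟨m₂, hm₂, hB⟩ := lower_bd δ hδ
    (fun q => (n * deriv T q.1 + pdA f q) * (2 * h q + q.2.1 * pdX h q + q.2.2 * pdY h q)
      + pdX f q * (pdY h q - q.2.1 * pdA h q)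
      + pdY f q * (- q.2.2 * pdA h q - pdX h q))
    (by fun_prop)
    (fun q => by
      simp only [hTp, hhper q, hXp q, hYp q, hAp q, fAp q, fXp q, fYp q])
    (fun q hq => by
      have := hπ q hq
      rw [wedge_formula h q (hhd q), grad_formula n T q (hTd _) f (hfd q)] at this
      simpa using this)
  obtain ⟨M, hM, hMb⟩ := fderiv_bd δ hδ h hhsm hhper
  obtain ⟨N, hN, hNb⟩ := fderiv_bd δ hδ f hfsm hfper
  have hn1 : (1 : ℝ) ≤ n := by exact_mod_cast hn
  have hm : 0 < min m₁ m₂ := lt_min hm₁ hm₂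
  set m := min m₁ m₂ with hmdef
  have hCpos : 0 < N * (M * (2 + δ)) := by positivity
  refine ⟨m / (2 * (N * (M * (2 + δ)))), by positivity, ?_⟩
  intro ρ hρs hρm hρI ⟨a, ha, hρ0⟩ _ hρe q hq
  have key : 0 < wedgeD (gradOf (fun x => n * T x.1 + ρ (rad x) * f x))
      (fun x => h x • alphaSt x) q := by
    have hA' := hA q hq
    have hB' := hB q hq
    have hrδ := rad_le δ hδ q hq
    rw [wedge_formula h q (hhd q)]
    rcases (Real.sqrt_nonneg (q.2.1 ^ 2 + q.2.2 ^ 2)).eq_or_lt with h0 | hr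
    · have h0' : rad q = 0 := h0.symm
      have hcont : Continuous rad := by unfold rad; fun_prop
      have hev : (fun x => ρ (rad x) * f x) =ᶠ[nhds q] (fun _ => (0:ℝ)) := by
        have : ∀ᶠ x in nhds q, rad x < min a δ :=
          hcont.continuousAt.eventually_lt continuousAt_const (by rw [h0']; exact lt_min ha hδ)
        filter_upwards [this] with x hx
        rw [hρ0 (rad x) ⟨Real.sqrt_nonneg _, (hx.trans_le (min_le_right _ _)).le⟩
          (hx.trans_le (min_le_left _ _)).le, zero_mul]
      have hfd0 := hev.fderiv_eq (𝕜 := ℝ)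
      rw [grad_formula n T q (hTd _) _
        (hev.differentiableAt_iff.2 (differentiableAt_const _))]
      simp only [pdA, pdX, pdY] at hA' ⊢
      rw [hfd0]
      simp
      nlinarith
    · have hr : 0 < rad q := hr
      have hrI : rad q ∈ Icc 0 δ := ⟨hr.le, hrδ⟩
      obtain ⟨cd, cA, cX, cY⟩ := cut_formula ρ f q hr ((hρs.differentiable (by simp)) _) (hfd q)
      rw [grad_formula n T q (hTd _) _ cd, cA, cX, cY]
      obtain ⟨bA, bX, bY⟩ := pd_bd h q M (hMb q hq)
      have bf := f_bd δ hδ f hfsm hfcore N hN hNb q hq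
      have hρ' := rho_deriv_nonneg δ hδ ρ hρs hρm (rad q) hrI
      have hρe' := hρe _ hrI
      obtain ⟨hρ0', hρ1'⟩ := hρI _ hrI
      have bx := abs_x_le q
      have by' := abs_y_le q
      have hr2 : rad q ^ 2 = q.2.1 ^ 2 + q.2.2 ^ 2 := Real.sq_sqrt (by positivity)
      have hK : |q.2.1 * pdY h q - q.2.2 * pdX h q - rad q ^ 2 * pdA h q|
          ≤ rad q * (M * (2 + δ)) := by
        calc _ ≤ |q.2.1 * pdY h q - q.2.2 * pdX h q| + |rad q ^ 2 * pdA h q| := abs_sub _ _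
          _ ≤ |q.2.1 * pdY h q| + |q.2.2 * pdX h q| + |rad q ^ 2 * pdA h q| := by
            gcongr; exact abs_sub _ _
          _ = |q.2.1| * |pdY h q| + |q.2.2| * |pdX h q| + rad q * rad q * |pdA h q| := by
            rw [abs_mul, abs_mul, abs_mul, abs_of_nonneg (sq_nonneg (rad q)), sq]
          _ ≤ rad q * M + rad q * M + rad q * δ * M := by gcongr
          _ = _ := by ring
      set K := q.2.1 * pdY h q - q.2.2 * pdX h q - rad q ^ 2 * pdA h q with hKdef
      have hE : |f q * deriv ρ (rad q) * (K / rad q)| ≤ m / 2 := by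
        rw [abs_mul, abs_mul, abs_div, abs_of_nonneg hρ', abs_of_pos hr]
        calc |f q| * deriv ρ (rad q) * (|K| / rad q)
            ≤ (N * rad q) * deriv ρ (rad q) * ((rad q * (M * (2 + δ))) / rad q) := by gcongr
          _ = (rad q * deriv ρ (rad q)) * (N * (M * (2 + δ))) := by field_simp
          _ ≤ (m / (2 * (N * (M * (2 + δ))))) * (N * (M * (2 + δ))) := by gcongr
          _ = m / 2 := by field_simp
      have hE' := (abs_le.1 hE).1
      have hmA : m ≤ n * (deriv T q.1 * (2 * h q + q.2.1 * pdX h q + q.2.2 * pdY h q)) := by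
        have : m ≤ m₁ := min_le_left _ _
        nlinarith
      have hmB := (min_le_right m₁ m₂).trans hB'
      rw [← hmdef] at hmB
      have c1 := mul_le_mul_of_nonneg_left hmA (sub_nonneg.2 hρ1')
      have c2 := mul_le_mul_of_nonneg_left hmB hρ0'
      have hKr : K / rad q = q.2.1 / rad q * (pdY h q - q.2.1 * pdA h q)
          + q.2.2 / rad q * (- q.2.2 * pdA h q - pdX h q) := by
        rw [hKdef, hr2]; field_simp; ring
      rw [hKr] at hE'
      simp only
      linarith
  refine ⟨key, fun h0 => ?_⟩
  rw [wedge_formula h q (hhd q), h0] at key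
  simp at key
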